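/- Let Q be a symmetric positive definite k×k real matrix, Θ = Diag(θ₁,…,θ_k) with θ_i > 0, γ > 0, λ > 0, β > 0, Z ∈ ℝ^{k×N}, and ψ(U) = ‖U‖₁ + ι_{[0,+∞)^{k×N}}(U) + (β/(2λ))‖U‖²_F. Then one step of the preconditioned forward–backward iteration, U_{t+1} = prox^Θ_{γλψ}(U_t − γΘ⁻¹Q(U_t − Z)), is given entrywise by the recurrent ReLU update (U_{t+1})_{i,j} = max(0, h_i z_{i,j} + Σ_{ℓ=1}^k W̃_{i,ℓ}((U_t)_{ℓ,j} − z_{ℓ,j}) − b_i), where W̃ = (Θ + γβI)⁻¹(Θ − γQ), h_i = θ_i/(θ_i+γβ), and b_i = γλ/(θ_i+γβ). -/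

import Mathlib

open Matrix
open scoped Classical

/-- The elastic-net-like regularizer
`ψ(U) = ‖U‖₁ + ι_{[0,∞)^{k×N}}(U) + (β/(2λ)) ‖U‖_F²`, with values in `(-∞, +∞]`. -/
noncomputable def elasticPsi (k N : ℕ) (lam β : ℝ)
    (U : Matrix (Fin k) (Fin N) ℝ) : EReal :=
  ((∑ i, ∑ j, |U i j| : ℝ) : EReal)
    + (if ∀ i j, 0 ≤ U i j then (0 : EReal) else ⊤)
    + ((β / (2 * lam) * Matrix.trace (Uᵀ * U) : ℝ) : EReal)

lemma elasticPsi_of_nonneg {k N : ℕ} (lam β : ℝ) {U : Matrix (Fin k) (Fin N) ℝ}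
    (hU : ∀ i j, 0 ≤ U i j) :
    elasticPsi k N lam β U =
      ((∑ i, ∑ j, (U i j + β / (2 * lam) * U i j ^ 2) : ℝ) : EReal) := by
  have htr : Matrix.trace (Uᵀ * U) = ∑ i, ∑ j, U i j ^ 2 := by
    simp only [Matrix.trace, Matrix.diag_apply, Matrix.mul_apply, Matrix.transpose_apply]
    rw [Finset.sum_comm]
    simp only [pow_two]
  rw [elasticPsi, if_pos hU, add_zero, ← EReal.coe_add, htr]
  simp only [abs_of_nonneg (hU _ _), Finset.sum_add_distrib, Finset.mul_sum]

lemma elasticPsi_of_not_nonneg {k N : ℕ} (lam β : ℝ) {U : Matrix (Fin k) (Fin N) ℝ}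
    (hU : ¬ ∀ i j, 0 ≤ U i j) : elasticPsi k N lam β U = ⊤ := by
  rw [elasticPsi, if_neg hU, EReal.coe_add_top, EReal.top_add_coe]

lemma trace_transpose_mul_diagonal_mul {k N : ℕ} (θ : Fin k → ℝ)
    (A : Matrix (Fin k) (Fin N) ℝ) :
    Matrix.trace (Aᵀ * Matrix.diagonal θ * A) = ∑ i, ∑ j, θ i * A i j ^ 2 := by
  simp only [Matrix.trace, Matrix.diag_apply, Matrix.mul_apply (M := Aᵀ * Matrix.diagonal θ),
    Matrix.mul_diagonal, Matrix.transpose_apply]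
  rw [Finset.sum_comm]
  exact Finset.sum_congr rfl fun i _ => Finset.sum_congr rfl fun j _ => by ring

/-- Strong convexity of the scalar proximal objective around its minimizer on `[0, ∞)`. -/
lemma scalar_prox_quadratic_growth {t m c d x : ℝ} (ht : 0 < t + d) (hx : 0 ≤ x) :
    1 / 2 * (t * (max 0 ((t * m - c) / (t + d)) - m) ^ 2)
        + (c * max 0 ((t * m - c) / (t + d))
          + d / 2 * max 0 ((t * m - c) / (t + d)) ^ 2)
        + (t + d) / 2 * (x - max 0 ((t * m - c) / (t + d))) ^ 2
      ≤ 1 / 2 * (t * (x - m) ^ 2) + (c * x + d / 2 * x ^ 2) := by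
  have he : (t + d) * ((t * m - c) / (t + d)) = t * m - c := mul_div_cancel₀ _ ht.ne'
  generalize (t * m - c) / (t + d) = s at he ⊢
  rcases le_total 0 s with hs | hs
  · rw [max_eq_right hs]
    linear_combination (s - x) * he
  · rw [max_eq_left hs]
    have : (t + d) * s * x ≤ 0 :=
      mul_nonpos_of_nonpos_of_nonneg (mul_nonpos_of_nonneg_of_nonpos ht.le hs) hx
    rw [he] at this
    linarith

/-- The weighted proximal point of `c` times the elastic penalty, computed entrywise. -/
lemma elasticPsi_prox_apply {k N : ℕ} {θ : Fin k → ℝ} (hθ : ∀ i, 0 < θ i)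
    {γ lam β : ℝ} (hγ : 0 < γ) (hlam : 0 < lam) (hβ : 0 < β)
    (M V : Matrix (Fin k) (Fin N) ℝ)
    (hmin : ∀ U : Matrix (Fin k) (Fin N) ℝ,
      ((1 / 2 * Matrix.trace ((V - M)ᵀ * Matrix.diagonal θ * (V - M)) : ℝ) : EReal)
          + ((γ * lam : ℝ) : EReal) * elasticPsi k N lam β V
        ≤ ((1 / 2 * Matrix.trace ((U - M)ᵀ * Matrix.diagonal θ * (U - M)) : ℝ) : EReal)
          + ((γ * lam : ℝ) : EReal) * elasticPsi k N lam β U)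
    (i : Fin k) (j : Fin N) :
    V i j = max 0 ((θ i * M i j - γ * lam) / (θ i + γ * β)) := by
  have hpos : ∀ i, 0 < θ i + γ * β := fun i => add_pos (hθ i) (mul_pos hγ hβ)
  let R : Matrix (Fin k) (Fin N) ℝ :=
    fun i j => max 0 ((θ i * M i j - γ * lam) / (θ i + γ * β))
  let f : Fin k → Fin N → ℝ → ℝ := fun i j x =>
    1 / 2 * (θ i * (x - M i j) ^ 2) + (γ * lam * x + γ * β / 2 * x ^ 2)
  have hobj : ∀ U : Matrix (Fin k) (Fin N) ℝ, (∀ i j, 0 ≤ U i j) →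
      ((1 / 2 * Matrix.trace ((U - M)ᵀ * Matrix.diagonal θ * (U - M)) : ℝ) : EReal)
          + ((γ * lam : ℝ) : EReal) * elasticPsi k N lam β U
        = ((∑ i, ∑ j, f i j (U i j) : ℝ) : EReal) := by
    intro U hU
    rw [elasticPsi_of_nonneg lam β hU, trace_transpose_mul_diagonal_mul, ← EReal.coe_mul,
      ← EReal.coe_add]
    simp only [Finset.mul_sum, ← Finset.sum_add_distrib, f, Matrix.sub_apply]
    congr 1
    refine Finset.sum_congr rfl fun i _ => Finset.sum_congr rfl fun j _ => ?_
    field_simp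
  have hR : ∀ i j, 0 ≤ R i j := fun i j => le_max_left _ _
  have hle := hmin R
  rw [hobj R hR] at hle
  have hV : ∀ i j, 0 ≤ V i j := by
    by_contra hneg
    rw [elasticPsi_of_not_nonneg lam β hneg, EReal.coe_mul_top_of_pos (mul_pos hγ hlam),
      EReal.coe_add_top] at hle
    exact EReal.coe_ne_top _ (top_le_iff.mp hle)
  rw [hobj V hV, EReal.coe_le_coe_iff] at hle
  have hgrow : ∑ i, ∑ j, (f i j (R i j) + (θ i + γ * β) / 2 * (V i j - R i j) ^ 2)
      ≤ ∑ i, ∑ j, f i j (V i j) :=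
    Finset.sum_le_sum fun i _ => Finset.sum_le_sum fun j _ =>
      scalar_prox_quadratic_growth (hpos i) (hV i j)
  simp only [Finset.sum_add_distrib] at hgrow
  have hnn : ∀ i j, 0 ≤ (θ i + γ * β) / 2 * (V i j - R i j) ^ 2 := fun i j =>
    mul_nonneg (half_pos (hpos i)).le (sq_nonneg _)
  have hterm : (θ i + γ * β) / 2 * (V i j - R i j) ^ 2 ≤ 0 :=
    calc (θ i + γ * β) / 2 * (V i j - R i j) ^ 2
        ≤ ∑ j, (θ i + γ * β) / 2 * (V i j - R i j) ^ 2 :=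
          Finset.single_le_sum (fun j _ => hnn i j) (Finset.mem_univ j)
      _ ≤ ∑ i, ∑ j, (θ i + γ * β) / 2 * (V i j - R i j) ^ 2 :=
          Finset.single_le_sum (f := fun i => ∑ j, (θ i + γ * β) / 2 * (V i j - R i j) ^ 2)
            (fun i _ => Finset.sum_nonneg fun j _ => hnn i j) (Finset.mem_univ i)
      _ ≤ 0 := by linarith
  have hsq : (V i j - R i j) ^ 2 ≤ 0 := by
    have := half_pos (hpos i)
    exact nonpos_of_mul_nonpos_right hterm this
  exact sub_eq_zero.mp (pow_eq_zero_iff two_ne_zero |>.mp (le_antisymm hsq (sq_nonneg _)))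

lemma inv_diagonal_of_pos {k : ℕ} {θ : Fin k → ℝ} (hθ : ∀ i, 0 < θ i) :
    (Matrix.diagonal θ)⁻¹ = Matrix.diagonal fun i => (θ i)⁻¹ := by
  refine Matrix.inv_eq_left_inv ?_
  rw [Matrix.diagonal_mul_diagonal, ← Matrix.diagonal_one]
  exact congrArg _ (funext fun i => inv_mul_cancel₀ (hθ i).ne')

/-- one step of the preconditioned forward-backward iteration
`U_{t+1} = prox^Θ_{γλψ}(U_t - γ Θ⁻¹ Q (U_t - Z))` is the recurrent ReLU update
with parameters `W̃ = (Θ+γβI)⁻¹(Θ-γQ)`, `h_i = θ_i/(θ_i+γβ)`,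
`b_i = γλ/(θ_i+γβ)`. -/
theorem stmt_12 (k N : ℕ)
    (Q : Matrix (Fin k) (Fin k) ℝ) (hQsymm : Q.IsSymm) (hQpos : Q.PosDef)
    (θ : Fin k → ℝ) (hθ : ∀ i, 0 < θ i)
    (γ lam β : ℝ) (hγ : 0 < γ) (hlam : 0 < lam) (hβ : 0 < β)
    (Z Ut : Matrix (Fin k) (Fin N) ℝ)
    (Θ : Matrix (Fin k) (Fin k) ℝ) (hΘ : Θ = Matrix.diagonal θ)
    (M : Matrix (Fin k) (Fin N) ℝ) (hM : M = Ut - γ • (Θ⁻¹ * Q * (Ut - Z)))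
    (W : Matrix (Fin k) (Fin k) ℝ)
    (hW : W = (Θ + (γ * β) • (1 : Matrix (Fin k) (Fin k) ℝ))⁻¹ * (Θ - γ • Q))
    (h b : Fin k → ℝ)
    (hh : ∀ i, h i = θ i / (θ i + γ * β))
    (hb : ∀ i, b i = γ * lam / (θ i + γ * β))
    (V : Matrix (Fin k) (Fin N) ℝ)
    (hmin : ∀ Wmat : Matrix (Fin k) (Fin N) ℝ,
      ((1 / 2 * Matrix.trace ((V - M)ᵀ * Θ * (V - M)) : ℝ) : EReal)
          + ((γ * lam : ℝ) : EReal) * elasticPsi k N lam β V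
        ≤ ((1 / 2 * Matrix.trace ((Wmat - M)ᵀ * Θ * (Wmat - M)) : ℝ) : EReal)
          + ((γ * lam : ℝ) : EReal) * elasticPsi k N lam β Wmat) :
    ∀ i : Fin k, ∀ j : Fin N,
      V i j = max 0 (h i * Z i j + (∑ l, W i l * (Ut l j - Z l j)) - b i) := by
  intro i j
  subst hΘ
  have hpos : ∀ i, 0 < θ i + γ * β := fun i => add_pos (hθ i) (mul_pos hγ hβ)
  rw [elasticPsi_prox_apply hθ hγ hlam hβ M V hmin i j]
  congr 1
  have hMij : θ i * M i j = θ i * Ut i j - γ * ∑ l, Q i l * (Ut l j - Z l j) := by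
    rw [hM, inv_diagonal_of_pos hθ, Matrix.mul_assoc]
    simp only [Matrix.sub_apply, Matrix.smul_apply, Matrix.diagonal_mul, Matrix.mul_apply (M := Q),
      smul_eq_mul]
    field_simp [(hθ i).ne']
  have hadd : Matrix.diagonal θ + (γ * β) • (1 : Matrix (Fin k) (Fin k) ℝ)
      = Matrix.diagonal fun i => θ i + γ * β := by
    rw [Matrix.smul_one_eq_diagonal, Matrix.diagonal_add]
  have hWsum : ∑ l, W i l * (Ut l j - Z l j)
      = (θ i + γ * β)⁻¹ * (θ i * (Ut i j - Z i j) - γ * ∑ l, Q i l * (Ut l j - Z l j)) := by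
    rw [hW, hadd, inv_diagonal_of_pos hpos]
    simp only [Matrix.diagonal_mul, Matrix.sub_apply, Matrix.smul_apply, smul_eq_mul, mul_assoc,
      sub_mul, ← Finset.mul_sum, Finset.sum_sub_distrib, Matrix.diagonal_apply, ite_mul, zero_mul,
      Finset.sum_ite_eq, Finset.mem_univ, if_true]
  rw [hMij, hWsum, hh, hb]
  have := (hpos i).ne'
  field_simp
  ring
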